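/- Let G(s), s ∈ [0,1], be a smooth path of self-adjoint operators on a finite-dimensional Hilbert space with uniformly simple ground state φ(s) of energy 0 and gap ≥ Δ > 0, and suppose all derivatives G^{(k)}(s₀) vanish at some s₀ ∈ [0,1] for k = 1, …, M. Then: (i) φ^{(k)}(s₀) is parallel to φ(s₀) for all k = 0,…,M, and (ii) the k-th derivative of the pseudo-inverse satisfies (G^{-1})^{(k)}(s₀) = 0 for all k = 1,…,M. -/

import Mathlib

open Real

local notation "⟪" x ", " y "⟫" => @inner ℂ _ _ x y

theorem iteratedDeriv_bilinear_eq_zero_left {F H K : Type*}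
    [NormedAddCommGroup F] [NormedSpace ℝ F] [NormedAddCommGroup H] [NormedSpace ℝ H]
    [NormedAddCommGroup K] [NormedSpace ℝ K] (B : F →L[ℝ] H →L[ℝ] K) {n : ℕ} {s₀ : ℝ}
    {f : ℝ → F} {g : ℝ → H} (hf : ContDiff ℝ (⊤ : ℕ∞) f) (hg : ContDiff ℝ (⊤ : ℕ∞) g)
    (h : ∀ k < n, iteratedDeriv k f s₀ = 0) :
    ∀ k < n, iteratedDeriv k (fun s => B (f s) (g s)) s₀ = 0 := by
  intro k
  induction k generalizing n f g with
  | zero =>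
    intro hk
    have h0 := h 0 hk
    rw [iteratedDeriv_zero] at h0 ⊢
    simp [h0]
  | succ k ih =>
    intro hk
    have hf' := (contDiff_infty_iff_deriv.1 hf).2
    have hg' := (contDiff_infty_iff_deriv.1 hg).2
    have hd : deriv (fun s => B (f s) (g s)) =
        (fun s => B (f s) (deriv g s)) + fun s => B (deriv f s) (g s) := by
      ext s
      exact (B.hasDerivAt_of_bilinear
        (fun _ => (hf.differentiable (by simp) s).hasDerivAt)
        (fun _ => (hg.differentiable (by simp) s).hasDerivAt)).deriv
    have h1 : ContDiff ℝ (⊤ : ℕ∞) fun s => B (f s) (deriv g s) :=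
      B.isBoundedBilinearMap.contDiff.comp (hf.prodMk hg')
    have h2 : ContDiff ℝ (⊤ : ℕ∞) fun s => B (deriv f s) (g s) :=
      B.isBoundedBilinearMap.contDiff.comp (hf'.prodMk hg)
    have hkinf : (k : WithTop ℕ∞) ≤ ((⊤ : ℕ∞) : WithTop ℕ∞) := by exact_mod_cast le_top
    rw [iteratedDeriv_succ', hd, iteratedDeriv_add (h1.of_le hkinf).contDiffAt
      (h2.of_le hkinf).contDiffAt, ih hf hg' h (by omega),
      ih (n := n - 1) hf' hg (fun j hj => ?_) (by omega), add_zero]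
    rw [← iteratedDeriv_succ']
    exact h (j + 1) (by omega)

theorem iteratedDeriv_bilinear_eq_zero_right {F H K : Type*}
    [NormedAddCommGroup F] [NormedSpace ℝ F] [NormedAddCommGroup H] [NormedSpace ℝ H]
    [NormedAddCommGroup K] [NormedSpace ℝ K] (B : F →L[ℝ] H →L[ℝ] K) {n : ℕ} {s₀ : ℝ}
    {f : ℝ → F} {g : ℝ → H} (hf : ContDiff ℝ (⊤ : ℕ∞) f) (hg : ContDiff ℝ (⊤ : ℕ∞) g)
    (h : ∀ k < n, iteratedDeriv k g s₀ = 0) :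
    ∀ k < n, iteratedDeriv k (fun s => B (f s) (g s)) s₀ = 0 :=
  iteratedDeriv_bilinear_eq_zero_left B.flip hg hf h

theorem iteratedDeriv_mul_mul_eq_zero {A : Type*} [NormedRing A] [NormedAlgebra ℝ A]
    {n : ℕ} {s₀ : ℝ} {u f v : ℝ → A} (hu : ContDiff ℝ (⊤ : ℕ∞) u) (hf : ContDiff ℝ (⊤ : ℕ∞) f)
    (hv : ContDiff ℝ (⊤ : ℕ∞) v) (h : ∀ k < n, iteratedDeriv k f s₀ = 0) :
    ∀ k < n, iteratedDeriv k (fun s => u s * f s * v s) s₀ = 0 :=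
  iteratedDeriv_bilinear_eq_zero_left (ContinuousLinearMap.mul ℝ A) (hu.mul hf) hv
    (iteratedDeriv_bilinear_eq_zero_right (ContinuousLinearMap.mul ℝ A) hu hf h)

/-- The derivative of a group inverse: here `a`, `b` stand for the derivatives of `g`, `x`. -/
theorem groupInverse_derivation_eq {A : Type*} [Ring A] {g x a b : A}
    (hcomm : g * x = x * g) (hgxg : g * x * g = g)
    (dcomm : a * x + g * b = b * g + x * a)
    (dxgx : (b * g + x * a) * x + x * g * b = b) :
    b = (1 - g * x) * a * (x * x) + x * x * a * (1 - g * x) - x * a * x := by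
  have hl : (1 - g * x) * g = 0 := by rw [sub_mul, one_mul, hgxg, sub_self]
  have hr : g * (1 - g * x) = 0 := by rw [hcomm, mul_sub, mul_one, ← mul_assoc, hgxg, sub_self]
  have hidem : (1 - g * x) * (1 - g * x) = 1 - g * x := by
    rw [mul_sub, mul_one, ← mul_assoc, hl, zero_mul, sub_zero]
  have hleft : (1 - g * x) * b = a * x * x + g * b * x := by
    have : (1 - g * x) * b = (b * g + x * a) * x := by
      rw [sub_mul, one_mul, hcomm, sub_eq_iff_eq_add, dxgx]
    rw [this, ← dcomm, add_mul]
  have hright : b * (1 - g * x) = x * x * a + x * b * g := by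
    have : b * (1 - g * x) = x * (a * x + g * b) := by
      rw [mul_sub, mul_one, sub_eq_iff_eq_add]
      nth_rewrite 1 [← dxgx]
      noncomm_ring
    rw [this, dcomm]
    noncomm_ring
  have hleft' : (1 - g * x) * b = (1 - g * x) * a * (x * x) := by
    calc (1 - g * x) * b = (1 - g * x) * ((1 - g * x) * b) := by rw [← mul_assoc, hidem]
      _ = (1 - g * x) * a * (x * x) + (1 - g * x) * g * (b * x) := by
        rw [hleft]; simp only [mul_add, mul_assoc]
      _ = _ := by rw [hl, zero_mul, add_zero]
  have hright' : b * (1 - g * x) = x * x * a * (1 - g * x) := by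
    calc b * (1 - g * x) = b * (1 - g * x) * (1 - g * x) := by rw [mul_assoc, hidem]
      _ = x * x * a * (1 - g * x) + x * b * (g * (1 - g * x)) := by
        rw [hright]; simp only [add_mul, mul_assoc]
      _ = _ := by rw [hr, mul_zero, add_zero]
  rw [← hleft', ← hright']
  calc b = b + b - b := by abel
    _ = b + b - ((b * g + x * a) * x + x * g * b) := by rw [dxgx]
    _ = (1 - x * g) * b + b * (1 - g * x) - x * a * x := by noncomm_ring
    _ = _ := by rw [hcomm]

theorem iteratedDeriv_groupInverse_eq_zero {A : Type*} [NormedRing A] [NormedAlgebra ℝ A]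
    {g x : ℝ → A} (hg : ContDiff ℝ (⊤ : ℕ∞) g) (hx : ContDiff ℝ (⊤ : ℕ∞) x)
    (hcomm : ∀ s, g s * x s = x s * g s) (hgxg : ∀ s, g s * x s * g s = g s)
    (hxgx : ∀ s, x s * g s * x s = x s) {n : ℕ} {s₀ : ℝ}
    (h : ∀ k < n, iteratedDeriv k (deriv g) s₀ = 0) :
    ∀ k < n, iteratedDeriv k (deriv x) s₀ = 0 := by
  have hg' := (contDiff_infty_iff_deriv.1 hg).2
  have hgd s : HasDerivAt g (deriv g s) s := (hg.differentiable (by simp) s).hasDerivAt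
  have hxd s : HasDerivAt x (deriv x s) s := (hx.differentiable (by simp) s).hasDerivAt
  have hP : ContDiff ℝ (⊤ : ℕ∞) fun s => 1 - g s * x s := contDiff_const.sub (hg.mul hx)
  have hd : deriv x = (fun s => (1 - g s * x s) * deriv g s * (x s * x s)) +
      (fun s => x s * x s * deriv g s * (1 - g s * x s)) - fun s => x s * deriv g s * x s := by
    ext s
    refine groupInverse_derivation_eq (hcomm s) (hgxg s) ?_ ?_
    · have h1 := (hgd s).mul (hxd s)
      rw [show g * x = x * g from funext hcomm] at h1
      exact h1.unique ((hxd s).mul (hgd s))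
    · have h1 := ((hxd s).mul (hgd s)).mul (hxd s)
      rw [show x * g * x = x from funext hxgx] at h1
      exact h1.unique (hxd s)
  intro k hk
  have hkinf : (k : WithTop ℕ∞) ≤ ((⊤ : ℕ∞) : WithTop ℕ∞) := by exact_mod_cast le_top
  have c1 := (((hP.mul hg').mul (hx.mul hx)).of_le hkinf).contDiffAt (x := s₀)
  have c2 := ((((hx.mul hx).mul hg').mul hP).of_le hkinf).contDiffAt (x := s₀)
  have c3 := (((hx.mul hg').mul hx).of_le hkinf).contDiffAt (x := s₀)
  rw [hd, iteratedDeriv_sub ?_ c3, iteratedDeriv_add c1 c2,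
    iteratedDeriv_mul_mul_eq_zero hP hg' (hx.mul hx) h k hk,
    iteratedDeriv_mul_mul_eq_zero (hx.mul hx) hg' hP h k hk,
    iteratedDeriv_mul_mul_eq_zero hx hg' hx h k hk, add_zero, sub_zero]
  exact c1.add c2

theorem stmt_16 {E : Type*} [NormedAddCommGroup E] [InnerProductSpace ℂ E]
    [FiniteDimensional ℂ E]
    (G Ginv : ℝ → (E →L[ℂ] E)) (hGsmooth : ContDiff ℝ (⊤ : ℕ∞) G)
    (hGinvsmooth : ContDiff ℝ (⊤ : ℕ∞) Ginv)
    (hsa : ∀ s, IsSelfAdjoint (G s))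
    (φ : ℝ → E) (hφsmooth : ContDiff ℝ (⊤ : ℕ∞) φ)
    (hφnorm : ∀ s, ‖φ s‖ = 1)
    (hground : ∀ s, G s (φ s) = 0)
    (Δ : ℝ) (hΔ : 0 < Δ)
    (hgap : ∀ s (v : E), ⟪φ s, v⟫ = 0 → Δ * ‖v‖ ^ 2 ≤ (⟪v, G s v⟫).re)
    (hphase : ∀ s, ⟪deriv φ s, φ s⟫ = 0)
    -- `Ginv` is the Moore–Penrose pseudo-inverse of `G`:
    (hGinvker : ∀ s, Ginv s (φ s) = 0)
    (hGinvG : ∀ s (v : E), G s (Ginv s v) = v - ⟪φ s, v⟫ • φ s)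
    (hGGinv : ∀ s (v : E), Ginv s (G s v) = v - ⟪φ s, v⟫ • φ s)
    (M : ℕ) (s₀ : ℝ) (hs₀ : s₀ ∈ Set.Icc (0 : ℝ) 1)
    (hvanish : ∀ k, 1 ≤ k → k ≤ M → iteratedDeriv k G s₀ = 0) :
    (∀ k ≤ M, ∃ c : ℂ, iteratedDeriv k φ s₀ = c • φ s₀) ∧
      (∀ k, 1 ≤ k → k ≤ M → iteratedDeriv k Ginv s₀ = 0) := by
  have hG' : ∀ k < M, iteratedDeriv k (deriv G) s₀ = 0 := fun k hk => by
    rw [← iteratedDeriv_succ']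
    exact hvanish (k + 1) (by omega) (by omega)
  have hdG := (contDiff_infty_iff_deriv.1 hGsmooth).2
  have hφd s : HasDerivAt φ (deriv φ s) s := (hφsmooth.differentiable (by simp) s).hasDerivAt
  have hGd s : HasDerivAt G (deriv G s) s := (hGsmooth.differentiable (by simp) s).hasDerivAt
  let B : (E →L[ℂ] E) →L[ℝ] E →L[ℝ] E :=
    (ContinuousLinearMap.id ℂ (E →L[ℂ] E)).bilinearRestrictScalars ℝ
  have hGφ s : G s (deriv φ s) = -(deriv G s (φ s)) := by
    have h1 : HasDerivAt (fun s => B (G s) (φ s)) (B (G s) (deriv φ s) + B (deriv G s) (φ s)) s :=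
      B.hasDerivAt_of_bilinear (fun _ => hGd s) (fun _ => hφd s)
    rw [show (fun s => B (G s) (φ s)) = fun _ => 0 from funext hground] at h1
    exact eq_neg_of_add_eq_zero_left (h1.unique (hasDerivAt_const s 0))
  have hφ' : deriv φ = fun s => B (-Ginv s) (B (deriv G s) (φ s)) := by
    ext s
    have h1 := hGGinv s (deriv φ s)
    rw [inner_eq_zero_symm.1 (hphase s), zero_smul, sub_zero, hGφ, map_neg] at h1
    exact h1.symm
  have hcomm s : G s * Ginv s = Ginv s * G s := by
    ext v
    exact (hGinvG s v).trans (hGGinv s v).symm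
  refine ⟨fun k hk => ?_, fun k hk1 hk => ?_⟩
  · rcases k with _ | k
    · exact ⟨1, by simp⟩
    · refine ⟨0, ?_⟩
      rw [iteratedDeriv_succ', hφ', zero_smul]
      exact iteratedDeriv_bilinear_eq_zero_right B hGinvsmooth.neg
        (B.isBoundedBilinearMap.contDiff.comp (hdG.prodMk hφsmooth))
        (iteratedDeriv_bilinear_eq_zero_left B hdG hφsmooth hG') k (by omega)
  · obtain ⟨k, rfl⟩ := Nat.exists_eq_add_of_le' hk1
    rw [iteratedDeriv_succ']
    refine iteratedDeriv_groupInverse_eq_zero hGsmooth hGinvsmooth hcomm (fun s => ?_)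
      (fun s => ?_) hG' k (by omega)
    · rw [mul_assoc]
      ext v
      change G s (Ginv s (G s v)) = G s v
      rw [hGGinv, map_sub, map_smul, hground, smul_zero, sub_zero]
    · rw [mul_assoc]
      ext v
      change Ginv s (G s (Ginv s v)) = Ginv s v
      rw [hGinvG, map_sub, map_smul, hGinvker, smul_zero, sub_zero]
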